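/- In A_3^{ℤ/4}, one has ((1+y_1)(1+y_2)(1+y_3))^4 = (1+[y_1,y_2])^2 (1+[y_1,y_3])^2 (1+[y_2,y_3])^2 (1+[[y_1,y_3],y_2])^2, where [a,b] = ab − ba. (This is the image under the Magnus-type representation e of the formula α_3^4 = ([x_1,x_2]^2[x_1,x_3]^2[x_2,x_3]^2)·[[x_1,x_3],x_2]^2.) -/

import Mathlib

noncomputable section

/-- The monomial `y_{i₁} y_{i₂} ⋯ y_{i_t}` in the free (tensor) algebra over `ℤ/4`
associated to a list of indices. -/
def mono (n : ℕ) (l : List (Fin n)) : FreeAlgebra (ZMod 4) (Fin n) :=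
  (l.map (FreeAlgebra.ι (ZMod 4))).prod

/-- The defining relations of `A_n^{ℤ/4}`: every monomial in which some generator repeats
(i.e. the index list is not `Nodup`) is identified with `0`.  Taking `RingQuot` of this
relation is exactly the quotient of the free (tensor) algebra over `ℤ/4` by the two-sided
ideal generated by these monomials. -/
inductive ARel (n : ℕ) : FreeAlgebra (ZMod 4) (Fin n) → FreeAlgebra (ZMod 4) (Fin n) → Prop
  | rel (l : List (Fin n)) (h : ¬ l.Nodup) : ARel n (mono n l) 0

/-- The algebra `A_n^{ℤ/4}`. -/
abbrev A (n : ℕ) : Type := RingQuot (ARel n)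

/-- The generators `y i` of `A_n^{ℤ/4}` (indexed by `Fin n`). -/
def y (n : ℕ) (i : Fin n) : A n := RingQuot.mkRingHom (ARel n) (FreeAlgebra.ι (ZMod 4) i)

/-- The augmentation ideal `I`: the two-sided ideal generated by the generators `y i`. -/
def Iaug (n : ℕ) : TwoSidedIdeal (A n) := TwoSidedIdeal.span (Set.range (y n))

/-- The ring commutator `[a,b] = a*b - b*a`. -/
def rc {R : Type*} [Ring R] (a b : R) : R := a * b - b * a

/-- A word with a repeated generator vanishes in `A n`. -/
theorem word_eq_zero (n : ℕ) (l : List (Fin n)) (h : ¬ l.Nodup) : (l.map (y n)).prod = 0 := by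
  have h1 := RingQuot.mkRingHom_rel (ARel.rel l h)
  rw [mono, map_list_prod, map_zero, List.map_map] at h1
  exact h1

theorem four_smul_eq_zero (x : A 3) : (4 : ℤ) • x = 0 := by
  have h : (4 : ℤ) • x = (4 : ZMod 4) • x := by
    rw [← Int.cast_smul_eq_zsmul (ZMod 4)]
    norm_num
  rw [h, show (4 : ZMod 4) = 0 from rfl, zero_smul]

/-- The identity holds over the integers up to an explicit multiple of four. -/
theorem generic_identity {R : Type*} [Ring R] (v : Fin 3 → R)
    (h : ∀ l : List (Fin 3), ¬ l.Nodup → (l.map v).prod = 0) :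
    ((1 + v 0) * (1 + v 1) * (1 + v 2)) ^ 4 =
      (1 + rc (v 0) (v 1)) ^ 2 * (1 + rc (v 0) (v 2)) ^ 2 *
        (1 + rc (v 1) (v 2)) ^ 2 * (1 + rc (rc (v 0) (v 2)) (v 1)) ^ 2 +
      (4 : ℤ) • ((5:ℤ) • (v 0 * v 1 * v 2) + v 2 + v 1 + (2:ℤ) • (v 1 * v 2) + v 0 + (2:ℤ) • (v 0 * v 2) + (2:ℤ) • (v 0 * v 1) + (2:ℤ) • (v 2 * v 1) + (2:ℤ) • (v 2 * v 0) +
        (3:ℤ) • (v 2 * v 0 * v 1) + (2:ℤ) • (v 1 * v 0) +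
        (3:ℤ) • (v 1 * v 0 * v 2) + (2:ℤ) • (v 1 * v 2 * v 0) + (2:ℤ) • (v 0 * v 2 * v 1) + (v 2 * v 1 * v 0)) := by
  have h2 : ∀ i, v i * v i = 0 := fun i => by simpa using h [i, i] (by simp)
  have h3 : ∀ i j, v i * (v j * v i) = 0 := fun i j => by simpa using h [i, j, i] (by simp)
  have h4 : ∀ i j k, v i * (v j * (v k * v i)) = 0 := fun i j k => by
    simpa using h [i, j, k, i] (by simp)
  have h2z : ∀ i z, v i * (v i * z) = 0 := fun i z => by
    rw [← mul_assoc, h2, zero_mul]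
  have h3z : ∀ i j z, v i * (v j * (v i * z)) = 0 := fun i j z => by
    have := congrArg (· * z) (h3 i j)
    simpa [mul_assoc] using this
  have h4z : ∀ i j k z, v i * (v j * (v k * (v i * z))) = 0 := fun i j k z => by
    have := congrArg (· * z) (h4 i j k)
    simpa [mul_assoc] using this
  have e4 : ∀ x : R, x ^ 4 = (x ^ 2) ^ 2 := fun x => by rw [← pow_mul]
  have p2 : ((1 + v 0) * (1 + v 1) * (1 + v 2)) ^ 2 = 
      1 +
      (2 : ℤ) • (v 2) +
      (2 : ℤ) • (v 1) +
      (3 : ℤ) • (v 1 * v 2) +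
      (2 : ℤ) • (v 0) +
      (3 : ℤ) • (v 0 * v 2) +
      (3 : ℤ) • (v 0 * v 1) +
      (4 : ℤ) • (v 0 * v 1 * v 2) +
      v 2 * v 1 +
      v 2 * v 0 +
      v 2 * v 0 * v 1 +
      v 1 * v 0 +
      v 1 * v 0 * v 2 +
      v 1 * v 2 * v 0 +
      v 0 * v 2 * v 1 := by
    simp only [pow_two, mul_add, add_mul, mul_assoc, mul_one, one_mul, h2, h3, h4, h2z, h3z, h4z,
      mul_zero, add_zero, zero_add]
    abel
  have q : ∀ i j, (1 + rc (v i) (v j)) ^ 2 = 1 + (2 : ℤ) • (v i * v j) - (2 : ℤ) • (v j * v i) := by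
    intro i j
    simp only [rc, pow_two, mul_add, add_mul, mul_sub, sub_mul, mul_assoc, mul_one, one_mul,
      h2, h3, h4, h2z, h3z, h4z, mul_zero, add_zero, zero_add, sub_zero]
    abel
  rw [e4, p2, q, q, q]
  simp only [rc, pow_two, mul_add, add_mul, mul_sub, sub_mul, mul_assoc, mul_one, one_mul,
    smul_mul_assoc, mul_smul_comm,
    h2, h3, h4, h2z, h3z, h4z, mul_zero, zero_mul, smul_zero, add_zero, zero_add, sub_zero,
    zero_sub]
  abel

/-- In `A_3^{ℤ/4}`,
`((1+y₁)(1+y₂)(1+y₃))⁴ = (1+[y₁,y₂])²(1+[y₁,y₃])²(1+[y₂,y₃])²(1+[[y₁,y₃],y₂])²`. -/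
theorem stmt_6 :
    ((1 + y 3 0) * (1 + y 3 1) * (1 + y 3 2)) ^ 4 =
      (1 + rc (y 3 0) (y 3 1)) ^ 2 * (1 + rc (y 3 0) (y 3 2)) ^ 2 *
        (1 + rc (y 3 1) (y 3 2)) ^ 2 * (1 + rc (rc (y 3 0) (y 3 2)) (y 3 1)) ^ 2 := by
  rw [generic_identity (y 3) (word_eq_zero 3), four_smul_eq_zero, add_zero]
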